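/- arXiv:2401.04974 — 16 statements merged into one kernel-verified Lean document; each statement's English description precedes it below -/
import Mathlib

section
/- For all q ∈ [0,1]: if q ≤ q^i then π(q) = 0; if q^i ≤ q ≤ q^ii then π(q) = (1+α_G)q − (1+α_L)(1−q)c; and if q ≥ q^ii then π(q) = 2(q − (1−q)c). (This is the content of Proposition 1: the receiver's optimal no-information strategy is RR on [0,q^i], AC on [q^i,q^ii], and AA on [q^ii,1].) -/
/-- Receiver's optimal payoff with no information. -/
noncomputable def pifn (c aL aG q : ℝ) : ℝ :=
  max 0 (max ((1 + aG) * q - (1 + aL) * (1 - q) * c) (2 * (q - (1 - q) * c)))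

/-- Threshold q^i. -/
noncomputable def qi (c aL aG : ℝ) : ℝ := c * (1 + aL) / ((1 + aG) + c * (1 + aL))

/-- Threshold q^ii. -/
noncomputable def qii (c aL aG : ℝ) : ℝ := c * (1 - aL) / ((1 - aG) + c * (1 - aL))

/-- Threshold q^m. -/
noncomputable def qm (c : ℝ) : ℝ := c / (1 + c)

/-- Receiver's expected stage payoff from acting. -/
noncomputable def ufn (c q : ℝ) : ℝ := q - (1 - q) * c

theorem stmt0 (c aL aG : ℝ) (hc : 0 < c) (hL : 0 < aL) (hLG : aL < aG) (hG : aG < 1) :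
    ∀ q ∈ Set.Icc (0 : ℝ) 1,
      (q ≤ qi c aL aG → pifn c aL aG q = 0) ∧
      (qi c aL aG ≤ q ∧ q ≤ qii c aL aG →
        pifn c aL aG q = (1 + aG) * q - (1 + aL) * (1 - q) * c) ∧
      (qii c aL aG ≤ q → pifn c aL aG q = 2 * (q - (1 - q) * c)) := by
  rintro q ⟨-, hq1⟩
  have h_gap : 0 ≤ (aG - aL) * ((1 - q) * c) :=
    mul_nonneg (by linarith) (mul_nonneg (by linarith) hc.le)
  have hdi : 0 < (1 + aG) + c * (1 + aL) := by
    have := mul_pos hc (show 0 < 1 + aL by linarith)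
    linarith
  have hdii : 0 < (1 - aG) + c * (1 - aL) := by
    have := mul_pos hc (show 0 < 1 - aL by linarith)
    linarith
  unfold pifn qi qii
  rw [le_div_iff₀ hdi, div_le_iff₀ hdi, le_div_iff₀ hdii, div_le_iff₀ hdii]
  refine ⟨fun h => ?_, fun ⟨h, h'⟩ => ?_, fun h => ?_⟩
  · have hu : q - (1 - q) * c ≤ 0 := by
      by_contra! hpos
      have := mul_pos (show 0 < 1 + aG by linarith) hpos
      linarith
    exact max_eq_left (max_le (by linarith) (by linarith))
  · rw [max_eq_right (le_max_of_le_left (by linarith)), max_eq_left (by linarith)]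
  · have hu : 0 ≤ q - (1 - q) * c := by
      by_contra! hneg
      have := mul_neg_of_pos_of_neg (show 0 < 1 - aG by linarith) hneg
      linarith
    rw [max_eq_right (le_max_of_le_right (by linarith)), max_eq_right (by linarith)]
end

section
/- For every q ∈ [0,1], N^U(q) ≤ N(q). In particular, the line through (q^i, 0) and (1, 2) passes weakly below the point (q^ii, 1 + q^ii·α_G + (1−q^ii)·α_L), so that the convex function N^U lies below the sender's no-information cost N. -/
/-- Sender's no-information cost. -/
noncomputable def Nfn (c aL aG q : ℝ) : ℝ :=
  if q ≤ qi c aL aG then 0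
  else if q ≤ qii c aL aG then 1 + q * aG + (1 - q) * aL
  else 2

/-- Sender's cost under Unconditional Information Provision. -/
noncomputable def NU (c aL aG q : ℝ) : ℝ :=
  max 0 (2 * (q - qi c aL aG) / (1 - qi c aL aG))

theorem one_sub_qi {c aL aG : ℝ} (hA : (1 + aG) + c * (1 + aL) ≠ 0) :
    1 - qi c aL aG = (1 + aG) / ((1 + aG) + c * (1 + aL)) := by
  unfold qi
  field_simp
  ring

theorem line_eq {c aL aG : ℝ} (q : ℝ) (hA : (1 + aG) + c * (1 + aL) ≠ 0) (hG : 1 + aG ≠ 0) :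
    2 * (q - qi c aL aG) / (1 - qi c aL aG) =
      2 * (q * (1 + aG) - (1 - q) * (c * (1 + aL))) / (1 + aG) := by
  rw [one_sub_qi hA]
  unfold qi
  field_simp
  ring

theorem line_le_of_le_qii {c aL aG q : ℝ} (hc : 0 < c) (hL : 0 < aL) (hLG : aL < aG)
    (hG : aG < 1) (hq1 : q ≤ 1) (hq : q ≤ qii c aL aG) :
    2 * (q - qi c aL aG) / (1 - qi c aL aG) ≤ 1 + q * aG + (1 - q) * aL := by
  have hG' : 0 < 1 + aG := by linarith
  have hA : 0 < (1 + aG) + c * (1 + aL) := by positivity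
  have hB : 0 < (1 - aG) + c * (1 - aL) :=
    add_pos (by linarith) (mul_pos hc (by linarith))
  rw [line_eq q hA.ne' hG'.ne', div_le_iff₀ hG']
  rw [qii, le_div_iff₀ hB] at hq
  have hcoef : c * (1 - aL) * (1 + aG) ≤ (1 + aL) * (1 + aG + 2 * c) := by
    have h : (1 - aL) * (1 + aG) ≤ 2 * (1 + aL) := by nlinarith
    nlinarith [mul_le_mul_of_nonneg_left h hc.le, mul_pos hL hG']
  have hscaled := mul_le_mul_of_nonneg_left hcoef (sub_nonneg.2 hq1)
  have hq' : q * (1 - aG) ≤ (1 - q) * (c * (1 - aL)) := by linarith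
  have := mul_le_mul_of_nonneg_right hq' hG'.le
  linarith

theorem qii_le_one {c aL aG : ℝ} (hc : 0 < c) (hLG : aL < aG) (hG : aG < 1) :
    qii c aL aG ≤ 1 := by
  have hB : 0 < (1 - aG) + c * (1 - aL) :=
    add_pos (by linarith) (mul_pos hc (by linarith))
  rw [qii, div_le_one hB]
  linarith

theorem stmt3 (c aL aG : ℝ) (hc : 0 < c) (hL : 0 < aL) (hLG : aL < aG) (hG : aG < 1) :
    (∀ q ∈ Set.Icc (0 : ℝ) 1, NU c aL aG q ≤ Nfn c aL aG q) ∧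
    2 * (qii c aL aG - qi c aL aG) / (1 - qi c aL aG) ≤
      1 + qii c aL aG * aG + (1 - qii c aL aG) * aL := by
  have hA : 0 < (1 + aG) + c * (1 + aL) := by
    have : 0 < aG := hL.trans hLG
    positivity
  have hpos : 0 < 1 - qi c aL aG := by
    rw [one_sub_qi hA.ne']
    exact div_pos (by linarith) hA
  refine ⟨fun q ⟨hq0, hq1⟩ => ?_, line_le_of_le_qii hc hL hLG hG (qii_le_one hc hLG hG) le_rfl⟩
  unfold NU Nfn
  split_ifs with h1 h2
  · exact max_le le_rfl (div_nonpos_of_nonpos_of_nonneg (by linarith) hpos.le)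
  · refine max_le ?_ (line_le_of_le_qii hc hL hLG hG hq1 h2)
    have := mul_nonneg hq0 (hL.trans hLG).le
    have := mul_nonneg (sub_nonneg.2 hq1) hL.le
    linarith
  · refine max_le zero_le_two ?_
    rw [div_le_iff₀ hpos]
    linarith
end

section
/- For every q ∈ [q^i, 1], π(q) ≤ 2(q − q^i)/(1 − q^i); that is, the sender's equilibrium cost under Unconditional Information Provision lies above the lower bound π(q). -/
theorem stmt4 (c aL aG : ℝ) (hc : 0 < c) (hL : 0 < aL) (hLG : aL < aG) (hG : aG < 1) :
    ∀ q ∈ Set.Icc (qi c aL aG) 1,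
      pifn c aL aG q ≤ 2 * (q - qi c aL aG) / (1 - qi c aL aG) := by
  rintro q ⟨hq, hq1⟩
  have hG' : 0 < 1 + aG := by linarith
  have hL' : 0 < 1 + aL := by linarith
  have hD : 0 < (1 + aG) + c * (1 + aL) := by positivity
  have hR : 2 * (q - qi c aL aG) / (1 - qi c aL aG) =
      2 * ((1 + aG) * q - (1 + aL) * (1 - q) * c) / (1 + aG) := by
    have h1 : 1 - qi c aL aG = (1 + aG) / ((1 + aG) + c * (1 + aL)) := by
      unfold qi
      field_simp
      ring
    rw [h1]
    unfold qi
    field_simp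
    ring
  have hN : 0 ≤ (1 + aG) * q - (1 + aL) * (1 - q) * c := by
    rw [qi, div_le_iff₀ hD] at hq
    linarith
  rw [hR, pifn]
  refine max_le (by positivity) (max_le ?_ ?_) <;> rw [le_div_iff₀ hG']
  · nlinarith
  · nlinarith [mul_nonneg (mul_nonneg hc.le (sub_nonneg.2 hq1)) (sub_nonneg.2 hLG.le)]
end

section
/- There exists a unique point p* ∈ (0,1) such that π(p*) = p*; moreover q^i < p*. (Existence and uniqueness part of Lemma 1.) -/
/-- A positive fixed point of `pifn` is a point where the larger of the two affine payoffs
equals the identity. -/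
theorem pifn_eq_self_iff {c aL aG p : ℝ} (hp : 0 < p) :
    pifn c aL aG p = p ↔
      ((1 + aG) * p - (1 + aL) * (1 - p) * c = p ∧ 2 * (p - (1 - p) * c) ≤ p) ∨
      ((1 + aG) * p - (1 + aL) * (1 - p) * c ≤ p ∧ 2 * (p - (1 - p) * c) = p) := by
  unfold pifn
  grind

theorem pifn_fixedPoint_unique {c aL aG p q : ℝ} (hc : 0 < c) (hL : 0 < aL) (hG : 0 < aG)
    (hp : 0 < p) (hq : 0 < q) (hpe : pifn c aL aG p = p) (hqe : pifn c aL aG q = q) :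
    p = q := by
  have hf : 0 < aG + (1 + aL) * c := by positivity
  have hg : 0 < 1 + 2 * c := by positivity
  have h_not_lt : ∀ {x y : ℝ}, 0 < x → 0 < y → pifn c aL aG x = x → pifn c aL aG y = y →
      ¬ x < y := by
    intro x y hx hy hxe hye hxy
    rw [pifn_eq_self_iff hx] at hxe
    rw [pifn_eq_self_iff hy] at hye
    have h1 := mul_pos hf (sub_pos.2 hxy)
    have h2 := mul_pos hg (sub_pos.2 hxy)
    rcases hxe with ⟨a, b⟩ | ⟨a, b⟩ <;> rcases hye with ⟨d, e⟩ | ⟨d, e⟩ <;> nlinarith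
  exact le_antisymm (not_lt.1 (h_not_lt hq hp hqe hpe))
    (not_lt.1 (h_not_lt hp hq hpe hqe))

theorem exists_pifn_fixedPoint {c aL aG : ℝ} (hc : 0 < c) (hL : 0 < aL) (hG : 0 < aG) :
    ∃ p ∈ Set.Ioo (0 : ℝ) 1, pifn c aL aG p = p := by
  have hf : 0 < aG + (1 + aL) * c := by positivity
  have hg : 0 < 1 + 2 * c := by positivity
  rcases le_total ((1 + aL) * c / (aG + (1 + aL) * c)) (2 * c / (1 + 2 * c)) with h | h
  · have h0 : 0 < (1 + aL) * c / (aG + (1 + aL) * c) := by positivity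
    refine ⟨_, ⟨h0, (div_lt_one hf).2 (by linarith)⟩, (pifn_eq_self_iff h0).2 (Or.inl ⟨?_, ?_⟩)⟩
    · field_simp
      ring
    · rw [le_div_iff₀ hg] at h
      linarith
  · have h0 : 0 < 2 * c / (1 + 2 * c) := by positivity
    refine ⟨_, ⟨h0, (div_lt_one hg).2 (by linarith)⟩, (pifn_eq_self_iff h0).2 (Or.inr ⟨?_, ?_⟩)⟩
    · rw [le_div_iff₀ hf] at h
      linarith
    · field_simp
      ring

theorem qi_lt_of_pifn_eq_self {c aL aG p : ℝ} (hc : 0 < c) (hL : 0 < aL) (hLG : aL < aG)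
    (hp : 0 < p) (hpe : pifn c aL aG p = p) : qi c aL aG < p := by
  have hG : 0 < aG := hL.trans hLG
  have hd : 0 < (1 + aG) + c * (1 + aL) := by positivity
  rw [qi, div_lt_iff₀ hd]
  rcases (pifn_eq_self_iff hp).1 hpe with ⟨h, -⟩ | ⟨-, h⟩
  · linarith
  · have h1 : (1 + aL) * (2 * c * (1 - p)) = (1 + aL) * p := by
      congr 1
      linarith
    have h2 := mul_pos (sub_pos.2 hLG) hp
    have h3 := mul_pos hG hp
    nlinarith

theorem stmt5 (c aL aG : ℝ) (hc : 0 < c) (hL : 0 < aL) (hLG : aL < aG) (hG : aG < 1) :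
    (∃! p : ℝ, p ∈ Set.Ioo (0 : ℝ) 1 ∧ pifn c aL aG p = p) ∧
    (∀ p ∈ Set.Ioo (0 : ℝ) 1, pifn c aL aG p = p → qi c aL aG < p) := by
  have hG0 : 0 < aG := hL.trans hLG
  refine ⟨?_, fun p hp hpe => qi_lt_of_pifn_eq_self hc hL hLG hp.1 hpe⟩
  obtain ⟨p, hp, hpe⟩ := exists_pifn_fixedPoint hc hL hG0
  exact ⟨p, ⟨hp, hpe⟩, fun q hq => pifn_fixedPoint_unique hc hL hG0 hq.1.1 hp.1 hq.2 hpe⟩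
end

section
/- p* ≥ q^ii if and only if 2α_G − α_L ≤ 1. (Lemma 1, part (a).) -/
theorem stmt6 (c aL aG pstar : ℝ) (hc : 0 < c) (hL : 0 < aL) (hLG : aL < aG) (hG : aG < 1)
    (hp : pstar ∈ Set.Ioo (0 : ℝ) 1) (hfix : pifn c aL aG pstar = pstar) :
    qii c aL aG ≤ pstar ↔ 2 * aG - aL ≤ 1 := by
  obtain ⟨hp0, hp1⟩ := hp
  have hden : 0 < (1 - aG) + c * (1 - aL) := by
    have := mul_pos hc (by linarith : 0 < 1 - aL)
    linarith
  have hy : 0 < (1 - pstar) * c := mul_pos (by linarith) hc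
  have hq : qii c aL aG ≤ pstar ↔ (1 - aL) * ((1 - pstar) * c) ≤ (1 - aG) * pstar := by
    rw [qii, div_le_iff₀ hden]
    constructor <;> intro h <;> linarith
  rw [hq]
  unfold pifn at hfix
  rw [mul_assoc (1 + aL)] at hfix
  generalize (1 - pstar) * c = y at hfix hy ⊢
  have hmax : max ((1 + aG) * pstar - (1 + aL) * y) (2 * (pstar - y)) = pstar := by
    rcases max_choice 0 (max ((1 + aG) * pstar - (1 + aL) * y) (2 * (pstar - y))) with h | h <;>
      linarith
  constructor
  · intro h
    rw [max_eq_right (by linarith)] at hmax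
    obtain rfl : pstar = 2 * y := by linarith
    by_contra! hlt
    nlinarith
  · intro h
    by_contra! hlt
    rw [max_eq_left (by linarith)] at hmax
    have hx : aG * pstar = (1 + aL) * y := by linarith
    have h1 : aG * ((1 - aG) * pstar) < aG * ((1 - aL) * y) :=
      mul_lt_mul_of_pos_left hlt (by linarith)
    have h2 : aG * ((1 - aG) * pstar) = (1 - aG) * ((1 + aL) * y) := by
      rw [← hx]; ring
    have h3 : 0 ≤ (1 + aL - 2 * aG) * y := mul_nonneg (by linarith) hy.le
    linarith
end

section
/- p* > q^m. (Lemma 1, part (b).) -/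
theorem stmt7 (c aL aG pstar : ℝ) (hc : 0 < c) (hL : 0 < aL) (hLG : aL < aG) (hG : aG < 1)
    (hp : pstar ∈ Set.Ioo (0 : ℝ) 1) (hfix : pifn c aL aG pstar = pstar) :
    qm c < pstar := by
  obtain ⟨h0, -⟩ := hp
  by_contra! h
  rw [qm, le_div_iff₀ (by linarith)] at h
  refine hfix.not_lt (max_lt h0 (max_lt ?_ (by linarith)))
  have hact : (1 + aL) * pstar ≤ (1 + aL) * ((1 - pstar) * c) :=
    mul_le_mul_of_nonneg_left (by linarith) (by linarith)
  nlinarith [mul_pos h0 hL, mul_pos h0 (sub_pos.2 hG)]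
end

section
/- For every q ∈ [0, p*], π(q) ≤ q, and for every q ∈ (p*, 1], π(q) > q. (Lemma 1, part (c): below the fixed point p*, the receiver's no-information payoff does not exceed the identity; above it, it strictly exceeds the identity.) -/
theorem stmt8 (c aL aG pstar : ℝ) (hc : 0 < c) (hL : 0 < aL) (hLG : aL < aG) (hG : aG < 1)
    (hp : pstar ∈ Set.Ioo (0 : ℝ) 1) (hfix : pifn c aL aG pstar = pstar) :
    (∀ q ∈ Set.Icc (0 : ℝ) pstar, pifn c aL aG q ≤ q) ∧
    (∀ q ∈ Set.Ioc pstar (1 : ℝ), q < pifn c aL aG q) := by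
  obtain ⟨hp0, -⟩ := hp
  have slope_one : 0 < aG + (1 + aL) * c := by
    have := mul_pos (by linarith : (0 : ℝ) < 1 + aL) hc
    linarith
  have slope_two : 0 < 1 + 2 * c := by linarith
  unfold pifn at *
  refine ⟨fun q ⟨hq0, hqp⟩ => ?_, fun q ⟨hpq, _⟩ => ?_⟩
  · have hle := hfix.le
    simp only [max_le_iff] at hle ⊢
    obtain ⟨-, h₁, h₂⟩ := hle
    refine ⟨hq0, ?_, ?_⟩
    · nlinarith [mul_nonneg slope_one.le (sub_nonneg.2 hqp)]
    · nlinarith [mul_nonneg slope_two.le (sub_nonneg.2 hqp)]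
  · have hge := hfix.ge
    simp only [le_max_iff] at hge
    simp only [lt_max_iff]
    rcases hge with h | h | h
    · linarith
    · right; left
      nlinarith [mul_pos slope_one (sub_pos.2 hpq)]
    · right; right
      nlinarith [mul_pos slope_two (sub_pos.2 hpq)]
end

section
/- If 2α_G − α_L ≤ 1, then p* = 2c/(1+2c); if 2α_G − α_L > 1, then p* = (1+α_L)c/(α_G + (1+α_L)c). (Explicit formulas for the fixed point p*, from the proof of Lemma 1.) -/
theorem stmt9 (c aL aG pstar : ℝ) (hc : 0 < c) (hL : 0 < aL) (hLG : aL < aG) (hG : aG < 1)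
    (hp : pstar ∈ Set.Ioo (0 : ℝ) 1) (hfix : pifn c aL aG pstar = pstar) :
    (2 * aG - aL ≤ 1 → pstar = 2 * c / (1 + 2 * c)) ∧
    (1 < 2 * aG - aL → pstar = (1 + aL) * c / (aG + (1 + aL) * c)) := by
  obtain ⟨hp0, hp1⟩ := hp
  have hy : 0 < (1 - pstar) * c := mul_pos (by linarith) hc
  have haG : 0 < aG := hL.trans hLG
  have hA : (1 + aG) * pstar - (1 + aL) * (1 - pstar) * c ≤ pstar :=
    ((le_max_left _ _).trans (le_max_right _ _)).trans_eq hfix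
  have hB : 2 * (pstar - (1 - pstar) * c) ≤ pstar :=
    ((le_max_right _ _).trans (le_max_right _ _)).trans_eq hfix
  have hAB : (1 + aG) * pstar - (1 + aL) * (1 - pstar) * c = pstar ∨
      2 * (pstar - (1 - pstar) * c) = pstar := by
    unfold pifn at hfix
    grind
  constructor
  · intro h
    rw [eq_div_iff (by positivity)]
    rcases hAB with hAB | hAB
    · have h1 : aG * (2 * ((1 - pstar) * c)) ≤ aG * pstar := by
        nlinarith [mul_le_mul_of_nonneg_right h hy.le]
      linarith [le_of_mul_le_mul_left h1 haG]
    · linarith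
  · intro h
    rw [eq_div_iff (by positivity)]
    rcases hAB with hAB | hAB
    · linarith
    · have hx : pstar = 2 * ((1 - pstar) * c) := by linarith
      have h1 : aG * pstar = aG * (2 * ((1 - pstar) * c)) := congrArg (aG * ·) hx
      nlinarith [mul_lt_mul_of_pos_right h hy]
end

section
/- The function ξ is strictly decreasing on [q^i, p*]: for all q, q' with q^i ≤ q < q' ≤ p*, one has ξ(q') < ξ(q). Moreover ξ(q^i) = q^i, ξ(p*) = 0, and 0 < ξ(q) < q^i for every q ∈ (q^i, p*). -/
/-- The split level ξ(q) = (q − π(q))/(1 − π(q)). -/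
noncomputable def xifn (c aL aG q : ℝ) : ℝ :=
  (q - pifn c aL aG q) / (1 - pifn c aL aG q)

theorem pifn_mono {c aL aG q q' : ℝ} (hc : 0 < c) (hL : 0 < aL) (hG : 0 < aG) (h : q ≤ q') :
    pifn c aL aG q ≤ pifn c aL aG q' := by
  have h1 : 0 ≤ (q' - q) * c := mul_nonneg (sub_nonneg.2 h) hc.le
  have h2 : 0 ≤ (q' - q) * c * aL := mul_nonneg h1 hL.le
  have h3 : 0 ≤ (q' - q) * aG := mul_nonneg (sub_nonneg.2 h) hG.le
  unfold pifn
  refine max_le_max le_rfl (max_le_max ?_ ?_) <;> linarith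

theorem nonneg_of_qi_le {c aL aG q : ℝ} (hc : 0 < c) (hL : 0 < aL) (hG : 0 < aG)
    (h : qi c aL aG ≤ q) : 0 ≤ (1 + aG) * q - (1 + aL) * (1 - q) * c := by
  unfold qi at h
  rw [div_le_iff₀ (by positivity)] at h
  linarith

theorem pifn_qi {c aL aG : ℝ} (hc : 0 < c) (hL : 0 < aL) (hLG : aL < aG) :
    pifn c aL aG (qi c aL aG) = 0 := by
  have hG : 0 < aG := hL.trans hLG
  have hD : 0 < (1 + aG) + c * (1 + aL) := by positivity
  have h1 : (1 + aG) * qi c aL aG - (1 + aL) * (1 - qi c aL aG) * c = 0 := by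
    unfold qi
    field_simp
    ring
  have h2 : 2 * (qi c aL aG - (1 - qi c aL aG) * c) ≤ 0 := by
    have : 2 * (qi c aL aG - (1 - qi c aL aG) * c)
        = -(2 * c * (aG - aL) / ((1 + aG) + c * (1 + aL))) := by
      unfold qi
      field_simp
      ring
    rw [this, neg_nonpos]
    exact div_nonneg (mul_nonneg (by positivity) (sub_nonneg.2 hLG.le)) hD.le
  unfold pifn
  rw [h1, max_eq_left h2, max_self]

/-- Above `qi`, the ratio `(1 - π(q)) / (1 - q)` is strictly decreasing (cross-multiplied form). -/
theorem one_sub_pifn_mul_lt {c aL aG q q' : ℝ} (hc : 0 < c) (hL : 0 < aL) (hG : 0 < aG)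
    (hq : qi c aL aG ≤ q) (hqq : q < q') (hq1 : q' < 1) :
    (1 - pifn c aL aG q') * (1 - q) < (1 - pifn c aL aG q) * (1 - q') := by
  have hx : 0 < 1 - q := by linarith
  have h1 : (1 + aG) * q' - (1 + aL) * (1 - q') * c ≤ pifn c aL aG q' :=
    le_max_of_le_right (le_max_left _ _)
  have h2 : 2 * (q' - (1 - q') * c) ≤ pifn c aL aG q' :=
    le_max_of_le_right (le_max_right _ _)
  have hπ : pifn c aL aG q
      = max ((1 + aG) * q - (1 + aL) * (1 - q) * c) (2 * (q - (1 - q) * c)) :=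
    max_eq_right (le_max_of_le_left (nonneg_of_qi_le hc hL hG hq))
  have hlt : 0 < q' - q := sub_pos.2 hqq
  rcases max_choice ((1 + aG) * q - (1 + aL) * (1 - q) * c) (2 * (q - (1 - q) * c)) with h | h
  · rw [hπ, h]
    have := mul_le_mul_of_nonneg_right h1 hx.le
    have := mul_pos hG hlt
    linarith
  · rw [hπ, h]
    have := mul_le_mul_of_nonneg_right h2 hx.le
    linarith

theorem xifn_lt_xifn {c aL aG q q' : ℝ} (hc : 0 < c) (hL : 0 < aL) (hG : 0 < aG)
    (hq : qi c aL aG ≤ q) (hqq : q < q') (hq1 : q' < 1) (hπ : pifn c aL aG q' < 1) :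
    xifn c aL aG q' < xifn c aL aG q := by
  have hπ' := (pifn_mono hc hL hG hqq.le).trans_lt hπ
  have := one_sub_pifn_mul_lt hc hL hG hq hqq hq1
  unfold xifn
  rw [div_lt_div_iff₀ (sub_pos.2 hπ) (sub_pos.2 hπ')]
  linarith

theorem stmt10 (c aL aG pstar : ℝ) (hc : 0 < c) (hL : 0 < aL) (hLG : aL < aG) (hG : aG < 1)
    (hp : pstar ∈ Set.Ioo (0 : ℝ) 1) (hfix : pifn c aL aG pstar = pstar) :
    (∀ q q' : ℝ, qi c aL aG ≤ q → q < q' → q' ≤ pstar →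
      xifn c aL aG q' < xifn c aL aG q) ∧
    xifn c aL aG (qi c aL aG) = qi c aL aG ∧
    xifn c aL aG pstar = 0 ∧
    (∀ q ∈ Set.Ioo (qi c aL aG) pstar, 0 < xifn c aL aG q ∧ xifn c aL aG q < qi c aL aG) := by
  have hG0 : 0 < aG := hL.trans hLG
  have hdec : ∀ q q' : ℝ, qi c aL aG ≤ q → q < q' → q' ≤ pstar →
      xifn c aL aG q' < xifn c aL aG q := fun q q' hq hqq hq' =>
    xifn_lt_xifn hc hL hG0 hq hqq (hq'.trans_lt hp.2)
      ((pifn_mono hc hL hG0 hq').trans_lt (hfix.trans_lt hp.2))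
  have hqi : xifn c aL aG (qi c aL aG) = qi c aL aG := by
    rw [xifn, pifn_qi hc hL hLG, sub_zero, sub_zero, div_one]
  have hps : xifn c aL aG pstar = 0 := by
    rw [xifn, hfix, sub_self, zero_div]
  exact ⟨hdec, hqi, hps, fun q hq =>
    ⟨hps.symm.trans_lt (hdec q pstar hq.1.le hq.2 le_rfl),
      (hdec _ q le_rfl hq.1 hq.2.le).trans_eq hqi⟩⟩
end

section
/- For every q ∈ [q^i, 1], ((1+α_G)q − (1+α_L)(1−q)c)/α_G ≥ 2(q − q^i)/(1 − q^i). (In the proof of Proposition 2: the sender's cost q·γ̂(q) from the best extreme strategy that keeps the receiver refraining in period 1 is at least the Unconditional-Information cost N^U(q).) -/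
theorem stmt11 (c aL aG : ℝ) (hc : 0 < c) (hL : 0 < aL) (hLG : aL < aG) (hG : aG < 1) :
    ∀ q ∈ Set.Icc (qi c aL aG) 1,
      2 * (q - qi c aL aG) / (1 - qi c aL aG) ≤
        ((1 + aG) * q - (1 + aL) * (1 - q) * c) / aG := by
  rintro q ⟨hq, -⟩
  have hG' : 0 < 1 + aG := by linarith
  have hD : 0 < (1 + aG) + c * (1 + aL) := by positivity
  have hN : 0 ≤ (1 + aG) * q - (1 + aL) * (1 - q) * c := by
    rw [qi, div_le_iff₀ hD] at hq
    linarith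
  have hqi : 1 - qi c aL aG = (1 + aG) / ((1 + aG) + c * (1 + aL)) := by
    rw [qi]
    field_simp
    ring
  have hcost : 2 * (q - qi c aL aG) / (1 - qi c aL aG) =
      2 * ((1 + aG) * q - (1 + aL) * (1 - q) * c) / (1 + aG) := by
    rw [hqi, qi]
    field_simp
    ring
  rw [hcost, div_le_div_iff₀ hG' (hL.trans hLG)]
  nlinarith [mul_nonneg hN (sub_nonneg.2 hG.le)]
end

section
/- If 2α_G − α_L ≤ 1, then for every q ∈ [p*, 1], π(q) = 2(q − (1−q)c); consequently π is affine on [p*, 1], i.e., for every λ ∈ [0,1], π((1−λ)p* + λ) = (1−λ)π(p*) + λ·π(1). (Case 1 of the proof of Theorem 1: when p* ≥ q^ii, splitting q into ⟨p*;1⟩ achieves the lower bound π(q).) -/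
theorem stmt12 (c aL aG pstar : ℝ) (hc : 0 < c) (hL : 0 < aL) (hLG : aL < aG) (hG : aG < 1)
    (hp : pstar ∈ Set.Ioo (0 : ℝ) 1) (hfix : pifn c aL aG pstar = pstar)
    (hcase : 2 * aG - aL ≤ 1) :
    (∀ q ∈ Set.Icc pstar (1 : ℝ), pifn c aL aG q = 2 * (q - (1 - q) * c)) ∧
    (∀ l ∈ Set.Icc (0 : ℝ) 1,
      pifn c aL aG ((1 - l) * pstar + l) =
        (1 - l) * pifn c aL aG pstar + l * pifn c aL aG 1) := by
  obtain ⟨hp0, hp1⟩ := hp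
  have hD : 0 ≤ (1 - aG) * pstar - (1 - aL) * (1 - pstar) * c := by
    unfold pifn at hfix
    rcases max_choice 0 (max ((1 + aG) * pstar - (1 + aL) * (1 - pstar) * c)
      (2 * (pstar - (1 - pstar) * c))) with h | h
    · linarith
    rw [h] at hfix
    rcases le_total ((1 + aG) * pstar - (1 + aL) * (1 - pstar) * c)
      (2 * (pstar - (1 - pstar) * c)) with h' | h'
    · linarith
    rw [max_eq_left h'] at hfix
    have key : (1 + aL) * ((1 - aG) * pstar - (1 - aL) * (1 - pstar) * c)
        = (1 + aL - 2 * aG) * pstar := by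
      linear_combination (1 - aL) * hfix
    refine nonneg_of_mul_nonneg_right (a := 1 + aL) ?_ (by linarith)
    rw [key]
    exact mul_nonneg (by linarith) hp0.le
  have hmain : ∀ q ∈ Set.Icc pstar (1 : ℝ), pifn c aL aG q = 2 * (q - (1 - q) * c) := by
    rintro q ⟨hpq, -⟩
    have hcq : 0 ≤ c * (q - pstar) := mul_nonneg hc.le (by linarith)
    have hDq : 0 ≤ (1 - aG) * q - (1 - aL) * (1 - q) * c := by
      have h1 : 0 ≤ (1 - aG) * (q - pstar) := mul_nonneg (by linarith) (by linarith)
      have h2 : 0 ≤ (1 - aL) * (c * (q - pstar)) := mul_nonneg (by linarith) hcq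
      linarith
    have hle : (1 + aG) * pstar - (1 + aL) * (1 - pstar) * c
        ≤ 2 * (pstar - (1 - pstar) * c) := by linarith
    have hpos : 0 ≤ 2 * (pstar - (1 - pstar) * c) := by
      by_contra! hneg
      have : pifn c aL aG pstar = 0 := by
        unfold pifn
        rw [max_eq_right hle, max_eq_left hneg.le]
      linarith
    unfold pifn
    have hinner : (1 + aG) * q - (1 + aL) * (1 - q) * c ≤ 2 * (q - (1 - q) * c) := by linarith
    rw [max_eq_right hinner, max_eq_right (by linarith)]
  refine ⟨hmain, ?_⟩
  rintro l ⟨hl0, hl1⟩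
  have h1 : 0 ≤ l * (1 - pstar) := mul_nonneg hl0 (by linarith)
  have h2 : 0 ≤ (1 - l) * (1 - pstar) := mul_nonneg (by linarith) (by linarith)
  rw [hmain _ ⟨by linarith, by linarith⟩, hmain pstar ⟨le_rfl, hp1.le⟩,
    hmain 1 ⟨hp1.le, le_rfl⟩]
  ring
end

section
/- If 2α_G − α_L > 1, then for every q ∈ (p*, 1), p* + ((q − p*)/(1 − p*))·(2 − p*) > π(q); that is, the line through (p*, π(p*)) = (p*, p*) and (1, π(1)) = (1, 2) lies strictly above π on the open interval (p*, 1). (Case 2 of the proof of Theorem 1: when p* < q^ii, the sender's optimal Action-Based cost N^A(q) strictly exceeds the lower bound π(q) for q > p*.) -/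
theorem stmt13 (c aL aG pstar : ℝ) (hc : 0 < c) (hL : 0 < aL) (hLG : aL < aG) (hG : aG < 1)
    (hp : pstar ∈ Set.Ioo (0 : ℝ) 1) (hfix : pifn c aL aG pstar = pstar)
    (hcase : 1 < 2 * aG - aL) :
    ∀ q ∈ Set.Ioo pstar (1 : ℝ),
      pifn c aL aG q < pstar + ((q - pstar) / (1 - pstar)) * (2 - pstar) := by
  rintro q ⟨hpq, hq1⟩
  obtain ⟨hp0, hp1⟩ := hp
  have h1p : 0 < 1 - pstar := by linarith
  have hA : (1 + aG) * pstar - (1 + aL) * (1 - pstar) * c ≤ pstar :=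
    (le_trans (le_max_left _ _) (le_max_right _ _)).trans hfix.le
  have hB : 2 * (pstar - (1 - pstar) * c) ≤ pstar :=
    (le_trans (le_max_right _ _) (le_max_right _ _)).trans hfix.le
  have hB' : 2 * (pstar - (1 - pstar) * c) < pstar := by
    refine lt_of_le_of_ne hB fun h => ?_
    have hcp : (1 - pstar) * c = pstar / 2 := by linarith
    rw [mul_assoc, hcp] at hA
    nlinarith [mul_pos hp0 (sub_pos.2 hcase)]
  obtain ⟨t, ht⟩ : ∃ t, t = (q - pstar) / (1 - pstar) := ⟨_, rfl⟩
  have ht0 : 0 < t := ht ▸ div_pos (by linarith) h1p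
  have ht1 : t < 1 := by rw [ht, div_lt_one h1p]; linarith
  have hq : q = pstar + t * (1 - pstar) := by rw [ht, div_mul_cancel₀ _ h1p.ne']; ring
  rw [← ht, hq, pifn]
  refine max_lt ?_ (max_lt ?_ ?_)
  · have := mul_pos ht0 (show 0 < 2 - pstar by linarith)
    linarith
  · linarith [mul_nonneg (sub_pos.2 ht1).le (sub_nonneg.2 hA), mul_pos ht0 (sub_pos.2 hG)]
  · linarith [mul_pos (sub_pos.2 ht1) (sub_pos.2 hB')]
end

section
/- If α_G ≤ 1/2, then for every q ∈ [0,1], u(q)/(1 − α_G) ≤ π(q). (Part (a) of Theorem 2: when α_G ≤ 1/2, the no-deviation constraint from acting in period 1 is never binding, so the Signal-Based equilibrium coincides with the Action-Based one.) -/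
theorem stmt14 (c aL aG : ℝ) (hc : 0 < c) (hL : 0 < aL) (hLG : aL < aG) (hG : aG < 1)
    (hhalf : aG ≤ 1 / 2) :
    ∀ q ∈ Set.Icc (0 : ℝ) 1, ufn c q / (1 - aG) ≤ pifn c aL aG q := by
  intro q _
  have hpos : 0 < 1 - aG := by linarith
  unfold pifn
  rcases le_total (ufn c q) 0 with hu | hu
  · exact (div_nonpos_of_nonpos_of_nonneg hu hpos.le).trans (le_max_left _ _)
  · have h : ufn c q / (1 - aG) ≤ 2 * ufn c q := by
      rw [div_le_iff₀ hpos]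
      nlinarith
    exact h.trans ((le_max_right _ _).trans (le_max_right _ _))
end

section
/- If α_G > 1/2, then there exists a unique p^e ∈ (q^m, q^ii) such that u(p^e)/(1 − α_G) = π(p^e); moreover p^e < p* (so p^e ∈ (q^m, min(p*, q^ii))), u(q)/(1 − α_G) < π(q) for all q ∈ [q^m, p^e), and u(q)/(1 − α_G) > π(q) for all q ∈ (p^e, q^ii]. -/
lemma pifn_eq_of_mem_Icc {c aL aG q : ℝ} (hc : 0 < c) (hL : 0 < aL) (hLG : aL < aG)
    (hG : aG < 1) (hq : q ∈ Set.Icc (qm c) (qii c aL aG)) :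
    pifn c aL aG q = (1 + aG) * q - (1 + aL) * (1 - q) * c := by
  obtain ⟨h1, h2⟩ := hq
  have hq0 : 0 < q := lt_of_lt_of_le (by unfold qm; positivity) h1
  have hden : 0 < (1 - aG) + c * (1 - aL) :=
    add_pos (by linarith) (mul_pos hc (by linarith))
  rw [qm, div_le_iff₀ (by linarith)] at h1
  rw [qii, le_div_iff₀ hden] at h2
  have hu : 0 ≤ q - (1 - q) * c := by linarith
  have hA : 2 * (q - (1 - q) * c) ≤ (1 + aG) * q - (1 + aL) * (1 - q) * c := by linarith
  rw [pifn, max_eq_left hA, max_eq_right (by linarith)]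

/-- The belief at which `ufn / (1 - aG)` crosses `pifn`. -/
noncomputable def crossing (c aL aG : ℝ) : ℝ :=
  (aG - aL * (1 - aG)) * c / (aG ^ 2 + (aG - aL * (1 - aG)) * c)

lemma crossing_coeff_pos {aL aG : ℝ} (hL : 0 < aL) (hLG : aL < aG) :
    0 < aG - aL * (1 - aG) := by
  nlinarith [mul_pos hL (hL.trans hLG)]

lemma crossing_denom_pos {c aL aG : ℝ} (hc : 0 < c) (hL : 0 < aL) (hLG : aL < aG) :
    0 < aG ^ 2 + (aG - aL * (1 - aG)) * c :=
  add_pos (pow_pos (hL.trans hLG) 2) (mul_pos (crossing_coeff_pos hL hLG) hc)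

lemma ufn_div_sub_pifn {c aL aG q : ℝ} (hc : 0 < c) (hL : 0 < aL) (hLG : aL < aG)
    (hG : aG < 1) (hq : q ∈ Set.Icc (qm c) (qii c aL aG)) :
    ufn c q / (1 - aG) - pifn c aL aG q =
      (aG ^ 2 + (aG - aL * (1 - aG)) * c) / (1 - aG) * (q - crossing c aL aG) := by
  have hM := (crossing_denom_pos hc hL hLG).ne'
  have h1 : 1 - aG ≠ 0 := by linarith
  rw [pifn_eq_of_mem_Icc hc hL hLG hG hq, ufn, crossing, div_mul_eq_mul_div,
    mul_sub (aG ^ 2 + _), mul_div_cancel₀ _ hM]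
  field_simp
  ring

lemma crossing_mem_Ioo {c aL aG : ℝ} (hc : 0 < c) (hL : 0 < aL) (hLG : aL < aG)
    (hG : aG < 1) (hhalf : 1 / 2 < aG) :
    crossing c aL aG ∈ Set.Ioo (qm c) (qii c aL aG) := by
  have hM := crossing_denom_pos hc hL hLG
  have hden : 0 < (1 - aG) + c * (1 - aL) :=
    add_pos (by linarith) (mul_pos hc (by linarith))
  constructor
  · rw [qm, crossing, div_lt_div_iff₀ (by linarith) hM]
    have h : 0 < c * ((1 - aG) * (aG - aL)) :=
      mul_pos hc (mul_pos (by linarith) (by linarith))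
    linarith
  · rw [qii, crossing, div_lt_div_iff₀ hM hden]
    have h : 0 < c * ((2 * aG - 1) * (aG - aL)) :=
      mul_pos hc (mul_pos (by linarith) (by linarith))
    linarith

lemma pifn_crossing_lt {c aL aG : ℝ} (hc : 0 < c) (hL : 0 < aL) (hLG : aL < aG)
    (hG : aG < 1) (hhalf : 1 / 2 < aG) :
    pifn c aL aG (crossing c aL aG) < crossing c aL aG := by
  have hmem := Set.Ioo_subset_Icc_self (crossing_mem_Ioo hc hL hLG hG hhalf)
  have hM := crossing_denom_pos hc hL hLG
  have h0 := ufn_div_sub_pifn hc hL hLG hG hmem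
  rw [sub_self, mul_zero, sub_eq_zero] at h0
  rw [← h0, div_lt_iff₀ (by linarith), ufn, crossing]
  have h : 0 < aG * aL * (1 - aG) * c :=
    mul_pos (mul_pos (mul_pos (by linarith) hL) (by linarith)) hc
  rw [← sub_pos]
  have : (aG - aL * (1 - aG)) * c / (aG ^ 2 + (aG - aL * (1 - aG)) * c) * (1 - aG) -
      ((aG - aL * (1 - aG)) * c / (aG ^ 2 + (aG - aL * (1 - aG)) * c) -
        (1 - (aG - aL * (1 - aG)) * c / (aG ^ 2 + (aG - aL * (1 - aG)) * c)) * c) =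
      aG * aL * (1 - aG) * c / (aG ^ 2 + (aG - aL * (1 - aG)) * c) := by
    field_simp
    ring
  rw [this]
  exact div_pos h hM

/-- Once `pifn` lies strictly below the diagonal, it has no positive fixed point to the left. -/
lemma lt_of_pifn_lt_of_pifn_eq {c aL aG p q : ℝ} (hc : 0 < c) (hL : 0 < aL) (hG : 0 < aG)
    (hq : pifn c aL aG q < q) (hp : 0 < p) (hfix : pifn c aL aG p = p) : q < p := by
  by_contra! hle
  simp only [pifn, max_lt_iff] at hq
  obtain ⟨-, hA, hB⟩ := hq
  have hstep : 0 ≤ q - p := by linarith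
  have e1 := mul_nonneg hG.le hstep
  have e2 := mul_nonneg hc.le hstep
  have e3 := mul_nonneg (mul_pos hL hc).le hstep
  have hlt : pifn c aL aG p < p :=
    max_lt hp (max_lt (by linarith) (by linarith))
  exact hlt.ne hfix

theorem stmt15 (c aL aG pstar : ℝ) (hc : 0 < c) (hL : 0 < aL) (hLG : aL < aG) (hG : aG < 1)
    (hp : pstar ∈ Set.Ioo (0 : ℝ) 1) (hfix : pifn c aL aG pstar = pstar)
    (hhalf : 1 / 2 < aG) :
    (∃! pe : ℝ, pe ∈ Set.Ioo (qm c) (qii c aL aG) ∧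
      ufn c pe / (1 - aG) = pifn c aL aG pe) ∧
    (∀ pe ∈ Set.Ioo (qm c) (qii c aL aG), ufn c pe / (1 - aG) = pifn c aL aG pe →
      pe < pstar ∧
      (∀ q ∈ Set.Ico (qm c) pe, ufn c q / (1 - aG) < pifn c aL aG q) ∧
      (∀ q ∈ Set.Ioc pe (qii c aL aG), pifn c aL aG q < ufn c q / (1 - aG))) := by
  have hpe := crossing_mem_Ioo hc hL hLG hG hhalf
  have hslope : 0 < (aG ^ 2 + (aG - aL * (1 - aG)) * c) / (1 - aG) :=
    div_pos (crossing_denom_pos hc hL hLG) (by linarith)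
  have hdiff : ∀ q ∈ Set.Icc (qm c) (qii c aL aG), ufn c q / (1 - aG) - pifn c aL aG q =
      (aG ^ 2 + (aG - aL * (1 - aG)) * c) / (1 - aG) * (q - crossing c aL aG) :=
    fun q hq => ufn_div_sub_pifn hc hL hLG hG hq
  have huniq : ∀ pe ∈ Set.Ioo (qm c) (qii c aL aG),
      ufn c pe / (1 - aG) = pifn c aL aG pe → pe = crossing c aL aG := by
    intro pe hmem heq
    have h := hdiff pe (Set.Ioo_subset_Icc_self hmem)
    rw [heq, sub_self, eq_comm, mul_eq_zero, or_iff_right hslope.ne', sub_eq_zero] at h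
    exact h
  refine ⟨⟨crossing c aL aG, ⟨hpe, ?_⟩, fun pe h => huniq pe h.1 h.2⟩, ?_⟩
  · have h := hdiff _ (Set.Ioo_subset_Icc_self hpe)
    rwa [sub_self, mul_zero, sub_eq_zero] at h
  · intro pe hmem heq
    obtain rfl := huniq pe hmem heq
    refine ⟨lt_of_pifn_lt_of_pifn_eq hc hL (hL.trans hLG)
      (pifn_crossing_lt hc hL hLG hG hhalf) hp.1 hfix, fun q hq => ?_, fun q hq => ?_⟩
    · rw [← sub_neg, hdiff q ⟨hq.1, (hq.2.trans hpe.2).le⟩]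
      exact mul_neg_of_pos_of_neg hslope (sub_neg.2 hq.2)
    · rw [← sub_pos, hdiff q ⟨(hpe.1.trans hq.1).le, hq.2⟩]
      exact mul_pos hslope (sub_pos.2 hq.1)
end

section
/- Let p** = c/(α_G + c). Then q^m < p** < 1, and if α_G > 1/2 then π(p**) < p** and consequently p** < p*. (From the proof of part (b) of Theorem 2: p** is the highest prior at which information disclosed only in period 2 can deter acting in period 1.) -/
/-- Once `pifn` lies strictly below the diagonal at `p`, it does so at every smaller positive prior. -/
theorem pifn_lt_self_of_le {c aL aG p q : ℝ} (hc : 0 < c) (hL : 0 < aL) (hG : 0 < aG)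
    (hp : pifn c aL aG p < p) (hq : 0 < q) (hqp : q ≤ p) : pifn c aL aG q < q := by
  simp only [pifn, max_lt_iff] at hp ⊢
  obtain ⟨-, h₁, h₂⟩ := hp
  have hd : 0 ≤ p - q := sub_nonneg.mpr hqp
  refine ⟨hq, ?_, ?_⟩
  · nlinarith [mul_nonneg hG.le hd, mul_nonneg hc.le hd, mul_nonneg (mul_pos hL hc).le hd]
  · nlinarith [mul_nonneg hc.le hd]

theorem pifn_div_add_lt_self {c aL aG : ℝ} (hc : 0 < c) (hL : 0 < aL) (hG : 1 / 2 < aG) :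
    pifn c aL aG (c / (aG + c)) < c / (aG + c) := by
  have hD : 0 < aG + c := by linarith
  have hcompl : 1 - c / (aG + c) = aG / (aG + c) := by
    field_simp
    ring
  simp only [pifn, max_lt_iff, hcompl]
  refine ⟨by positivity, ?_, ?_⟩
  · have h : (1 + aG) * (c / (aG + c)) - (1 + aL) * (aG / (aG + c)) * c
        = c * (1 - aL * aG) / (aG + c) := by ring
    rw [h]
    gcongr
    nlinarith [mul_pos hc (mul_pos hL (by linarith : 0 < aG))]
  · have h : 2 * (c / (aG + c) - aG / (aG + c) * c) = 2 * c * (1 - aG) / (aG + c) := by ring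
    rw [h]
    gcongr
    nlinarith

theorem stmt16 (c aL aG pstar : ℝ) (hc : 0 < c) (hL : 0 < aL) (hLG : aL < aG) (hG : aG < 1)
    (hp : pstar ∈ Set.Ioo (0 : ℝ) 1) (hfix : pifn c aL aG pstar = pstar) :
    qm c < c / (aG + c) ∧ c / (aG + c) < 1 ∧
    (1 / 2 < aG →
      pifn c aL aG (c / (aG + c)) < c / (aG + c) ∧ c / (aG + c) < pstar) := by
  have hG0 : 0 < aG := hL.trans hLG
  have hD : 0 < aG + c := by linarith
  refine ⟨?_, ?_, fun hhalf => ?_⟩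
  · exact div_lt_div_of_pos_left hc hD (by linarith)
  · rw [div_lt_one hD]
    linarith
  · have hlt := pifn_div_add_lt_self hc hL hhalf
    refine ⟨hlt, lt_of_not_ge fun hle => ?_⟩
    exact (pifn_lt_self_of_le hc hL hG0 hlt hp.1 hle).ne hfix
end

section
/- If α_G > 1/2 and p^e ∈ (q^m, min(p*, q^ii)) satisfies u(p^e)/(1 − α_G) = π(p^e), then for every q ∈ (p^e, 1), π(p^e) + ((q − p^e)/(1 − p^e))·(2 − π(p^e)) > π(q); that is, the line through (p^e, π(p^e)) and (1, π(1)) = (1, 2) lies strictly above π on (p^e, 1). (This yields the conclusion of Theorem 2 that the Signal-Based equilibrium cost N^S(q) strictly exceeds the lower bound π(q) for q > p^e.) -/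
theorem stmt19 (c aL aG pstar pe : ℝ) (hc : 0 < c) (hL : 0 < aL) (hLG : aL < aG) (hG : aG < 1)
    (hp : pstar ∈ Set.Ioo (0 : ℝ) 1) (hfix : pifn c aL aG pstar = pstar)
    (hhalf : 1 / 2 < aG)
    (hpe : pe ∈ Set.Ioo (qm c) (min pstar (qii c aL aG)))
    (hpefix : ufn c pe / (1 - aG) = pifn c aL aG pe) :
    ∀ q ∈ Set.Ioo pe (1 : ℝ),
      pifn c aL aG q <
        pifn c aL aG pe + ((q - pe) / (1 - pe)) * (2 - pifn c aL aG pe) := by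
  rintro q ⟨hq, hq1⟩
  have hu : 0 < ufn c pe := by
    have h := hpe.1
    rw [qm, div_lt_iff₀ (by linarith)] at h
    unfold ufn
    linarith
  have hP : 2 * ufn c pe < pifn c aL aG pe := by
    rw [← hpefix, lt_div_iff₀ (by linarith)]
    nlinarith
  have hA : (1 + aG) * pe - (1 + aL) * (1 - pe) * c ≤ pifn c aL aG pe :=
    (le_max_left _ _).trans (le_max_right _ _)
  generalize pifn c aL aG pe = P at hP hA ⊢
  obtain ⟨t, ht⟩ : ∃ t, t = (q - pe) / (1 - pe) := ⟨_, rfl⟩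
  have hpos : 0 < 1 - pe := by linarith
  have ht0 : 0 < t := ht ▸ div_pos (by linarith) hpos
  have ht1 : t < 1 := by
    rw [ht, div_lt_one hpos]
    linarith
  have hqt : q = pe + t * (1 - pe) := by
    rw [ht]
    field_simp
    ring
  rw [← ht, hqt]
  have hs : 0 < 1 - t := by linarith
  unfold ufn at hu hP
  refine max_lt ?_ (max_lt ?_ ?_)
  · nlinarith [mul_pos hs (show 0 < P by linarith)]
  · nlinarith [mul_le_mul_of_nonneg_left hA hs.le, mul_pos ht0 (show 0 < 1 - aG by linarith)]
  · nlinarith [mul_lt_mul_of_pos_left hP hs]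
end
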